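/- Let ℓ be a continuous proper length function on Γ⋉X and let p > 0. Suppose Γ⋉X has the rapid decay property with respect to ℓ and p, i.e., there is C > 0 with ‖f‖_red ≤ C·‖f‖_{2,p,ℓ} for all f ∈ C_c(Γ⋉X). Let k > p be an integer. Then there exists D > 0, independent of the choice of functionals below, such that: for any two linear functionals φ, ψ on C_c(Γ⋉X) that are bounded of norm at most 1 with respect to ‖·‖_red and satisfy φ(h) = ψ(h) for every h ∈ C_c(Γ⋉X) with h(g,·) ≡ 0 for all g ≠ e, one has |φ(f) − ψ(f)| ≤ D for every f ∈ C_c(Γ⋉X) with L_ℓ^k(f) ≤ 1. (In particular each fibre S_η of the state space has finite diameter, uniformly bounded over η.) -/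

import Mathlib

open scoped ENNReal

noncomputable section

variable {Γ X : Type*} [Group Γ] [TopologicalSpace X] [MulAction Γ X]

/-- `f ∈ C_c(Γ ⋉ X)` : each `f g : X → ℂ` is continuous, and `f g ≡ 0` for all but
finitely many `g ∈ Γ`. -/
def IsCc (f : Γ → X → ℂ) : Prop :=
  (∀ g : Γ, Continuous (f g)) ∧ {g : Γ | f g ≠ 0}.Finite

/-- Convolution: `(f ∗ ξ)(g, x) = Σ_{h ∈ Γ} f (g h⁻¹, h ⋅ x) ξ (h, x)`. -/
def convCc (f ξ : Γ → X → ℂ) : Γ → X → ℂ :=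
  fun g x => ∑ᶠ h : Γ, f (g * h⁻¹) (h • x) * ξ h x

/-- Involution: `f^*(g, x) = conj (f (g⁻¹, g ⋅ x))`. -/
def starCc (f : Γ → X → ℂ) : Γ → X → ℂ :=
  fun g x => (starRingEnd ℂ) (f g⁻¹ (g • x))

/-- Pointwise multiplication by the length function: `M_ℓ(f)(g,x) = ℓ(g,x) f(g,x)`. -/
def mulLen (ℓ : Γ → X → ℝ) (f : Γ → X → ℂ) : Γ → X → ℂ :=
  fun g x => (ℓ g x : ℂ) * f g x

/-- Iterated derivation: `Δ⁰(f)(ξ) = f ∗ ξ` and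
`Δ^k(f)(ξ) = M_ℓ(Δ^{k-1}(f)(ξ)) − Δ^{k-1}(f)(M_ℓ(ξ))`. -/
def deltaIter (ℓ : Γ → X → ℝ) (f : Γ → X → ℂ) : ℕ → (Γ → X → ℂ) → Γ → X → ℂ
  | 0, ξ => convCc f ξ
  | k + 1, ξ => mulLen ℓ (deltaIter ℓ f k ξ) - deltaIter ℓ f k (mulLen ℓ ξ)

/-- Hilbert-module norm: `‖ξ‖ = sup_{x ∈ X} (Σ_{g ∈ Γ} |ξ(g,x)|²)^{1/2}`. -/
def hnorm (ξ : Γ → X → ℂ) : ℝ :=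
  ⨆ x : X, Real.sqrt (∑ᶠ g : Γ, ‖ξ g x‖ ^ 2)

/-- The I-norm `‖f‖_I`. -/
def normI (f : Γ → X → ℂ) : ℝ :=
  max (⨆ x : X, ∑ᶠ g : Γ, ‖f g x‖) (⨆ x : X, ∑ᶠ g : Γ, ‖f g⁻¹ (g • x)‖)

/-- The `C(X)`-valued inner product: `⟨⟨ξ, η⟩⟩(x) = Σ_{g ∈ Γ} conj(ξ(g,x)) η(g,x)`. -/
def innerCc (ξ η : Γ → X → ℂ) (x : X) : ℂ :=
  ∑ᶠ g : Γ, (starRingEnd ℂ) (ξ g x) * η g x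

/-- Reduced norm: `‖f‖_red = sup { ‖f ∗ ξ‖ : ξ ∈ C_c, ‖ξ‖ ≤ 1 }`. -/
def redNorm (f : Γ → X → ℂ) : ℝ :=
  sSup {r : ℝ | ∃ ξ : Γ → X → ℂ, IsCc ξ ∧ hnorm ξ ≤ 1 ∧ r = hnorm (convCc f ξ)}

/-- The quasi-seminorm `L_ℓ^k(f) = sup { ‖Δ^k(f)(ξ)‖ : ξ ∈ C_c, ‖ξ‖ ≤ 1 }`. -/
def lipK (ℓ : Γ → X → ℝ) (k : ℕ) (f : Γ → X → ℂ) : ℝ :=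
  sSup {r : ℝ | ∃ ξ : Γ → X → ℂ, IsCc ξ ∧ hnorm ξ ≤ 1 ∧ r = hnorm (deltaIter ℓ f k ξ)}

/-- `‖f‖_{2,p,s,ℓ}`. -/
def norm2s (ℓ : Γ → X → ℝ) (p : ℝ) (f : Γ → X → ℂ) : ℝ :=
  ⨆ x : X, Real.sqrt (∑ᶠ g : Γ, ‖f g x‖ ^ 2 * (1 + ℓ g x) ^ (2 * p))

/-- `‖f‖_{2,p,r,ℓ}`. -/
def norm2r (ℓ : Γ → X → ℝ) (p : ℝ) (f : Γ → X → ℂ) : ℝ :=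
  ⨆ x : X, Real.sqrt (∑ᶠ g : Γ, ‖f g⁻¹ (g • x)‖ ^ 2 * (1 + ℓ g x) ^ (2 * p))

/-- `‖f‖_{2,p,ℓ} = max (‖f‖_{2,p,s,ℓ}, ‖f‖_{2,p,r,ℓ})`. -/
def norm2 (ℓ : Γ → X → ℝ) (p : ℝ) (f : Γ → X → ℂ) : ℝ :=
  max (norm2s ℓ p f) (norm2r ℓ p f)

/-- A length function on the transformation groupoid `Γ ⋉ X`. -/
def IsLength (ℓ : Γ → X → ℝ) : Prop :=
  (∀ g : Γ, Continuous (ℓ g)) ∧ (∀ (g : Γ) (x : X), 0 ≤ ℓ g x) ∧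
    (∀ (g : Γ) (x : X), ℓ g x = 0 ↔ g = 1) ∧
    (∀ (g : Γ) (x : X), ℓ g⁻¹ (g • x) = ℓ g x) ∧
    (∀ (g h : Γ) (x : X), ℓ (g * h) x ≤ ℓ g (h • x) + ℓ h x)

/-- Properness: for every `R ≥ 0`, only finitely many non-identity `g` satisfy
`ℓ(g, x) ≤ R` for some `x`. -/
def IsProperLen (ℓ : Γ → X → ℝ) : Prop :=
  ∀ R : ℝ, {g : Γ | g ≠ 1 ∧ ∃ x : X, ℓ g x ≤ R}.Finite

set_option linter.unusedSectionVars false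

lemma IsCc.exists_finset {f : Γ → X → ℂ} (hf : IsCc f) :
    ∃ S : Finset Γ, ∀ g, g ∉ S → f g = 0 :=
  ⟨hf.2.toFinset, fun g hg => by simpa using hg⟩

lemma isCc_of_finset {f : Γ → X → ℂ} (hc : ∀ g, Continuous (f g)) (S : Finset Γ)
    (hS : ∀ g, g ∉ S → f g = 0) : IsCc f :=
  ⟨hc, S.finite_toSet.subset fun g hg => by
    by_contra h
    exact hg (hS g h)⟩

lemma finsum_eq_sum_of_forall_notMem {M : Type*} [AddCommMonoid M] {u : Γ → M}
    (S : Finset Γ) (hS : ∀ g, g ∉ S → u g = 0) : ∑ᶠ g, u g = ∑ g ∈ S, u g :=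
  finsum_eq_sum_of_support_subset u fun g hg => by
    by_contra h
    exact hg (hS g h)

lemma convCc_apply {f ξ : Γ → X → ℂ} (T : Finset Γ) (hT : ∀ h, h ∉ T → ξ h = 0)
    (g : Γ) (x : X) : convCc f ξ g x = ∑ h ∈ T, f (g * h⁻¹) (h • x) * ξ h x :=
  finsum_eq_sum_of_forall_notMem T fun h hh => by simp [hT h hh]

lemma deltaIter_apply (ℓ : Γ → X → ℝ) (f : Γ → X → ℂ) (k : ℕ) {ξ : Γ → X → ℂ}
    (T : Finset Γ) (hT : ∀ h, h ∉ T → ξ h = 0) (g : Γ) (x : X) :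
    deltaIter ℓ f k ξ g x =
      ∑ h ∈ T, ((ℓ g x : ℂ) - ℓ h x) ^ k * f (g * h⁻¹) (h • x) * ξ h x := by
  induction k generalizing ξ with
  | zero => simp [deltaIter, convCc_apply T hT]
  | succ k ih =>
    have hT' : ∀ h, h ∉ T → mulLen ℓ ξ h = 0 := fun h hh => by
      ext x; simp [mulLen, hT h hh]
    simp only [deltaIter, Pi.sub_apply, ih hT']
    rw [mulLen, ih hT, Finset.mul_sum, ← Finset.sum_sub_distrib]
    refine Finset.sum_congr rfl fun h _ => ?_
    simp only [mulLen]
    ring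

lemma isCc_deltaIter [ContinuousConstSMul Γ X] {ℓ : Γ → X → ℝ}
    (hℓ : ∀ g, Continuous (ℓ g)) {f ξ : Γ → X → ℂ} (hf : IsCc f) (hξ : IsCc ξ) (k : ℕ) :
    IsCc (deltaIter ℓ f k ξ) := by
  classical
  obtain ⟨S, hS⟩ := hf.exists_finset
  obtain ⟨T, hT⟩ := hξ.exists_finset
  refine isCc_of_finset (fun g => ?_) (Finset.image₂ (· * ·) S T) fun g hg => ?_
  · have : deltaIter ℓ f k ξ g = fun x =>
        ∑ h ∈ T, ((ℓ g x : ℂ) - ℓ h x) ^ k * f (g * h⁻¹) (h • x) * ξ h x :=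
      funext fun x => deltaIter_apply ℓ f k T hT g x
    rw [this]
    refine continuous_finsetSum _ fun h _ => ?_
    exact ((((Complex.continuous_ofReal.comp (hℓ g)).sub
      (Complex.continuous_ofReal.comp (hℓ h))).pow k).mul
      ((hf.1 _).comp (continuous_const_smul h))).mul (hξ.1 h)
  · ext x
    rw [deltaIter_apply ℓ f k T hT]
    refine Finset.sum_eq_zero fun h hh => ?_
    rw [hS (g * h⁻¹)]
    · simp
    · intro hmem
      exact hg (Finset.mem_image₂.2 ⟨_, hmem, h, hh, by simp⟩)

lemma IsCc.sqrt_le_hnorm [CompactSpace X] {ξ : Γ → X → ℂ} (hξ : IsCc ξ) (x : X) :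
    √(∑ᶠ g : Γ, ‖ξ g x‖ ^ 2) ≤ hnorm ξ := by
  obtain ⟨T, hT⟩ := hξ.exists_finset
  have hsum (y : X) : ∑ᶠ g : Γ, ‖ξ g y‖ ^ 2 = ∑ g ∈ T, ‖ξ g y‖ ^ 2 :=
    finsum_eq_sum_of_forall_notMem T fun g hg => by simp [hT g hg]
  have hcont : Continuous fun y : X => √(∑ᶠ g : Γ, ‖ξ g y‖ ^ 2) := by
    simp only [hsum]
    have := hξ.1
    fun_prop
  exact le_ciSup (isCompact_range hcont).bddAbove x

/-- Schur-type bound for the matrix of `Δ^k(f)` in a fibre. -/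
lemma sum_sq_norm_le {S T W : Finset Γ} {a : Γ → Γ → ℂ} {u : Γ → ℂ} {B : ℝ}
    (ha : ∀ g h, ‖a g h‖ ≤ B) (ha0 : ∀ g h, g * h⁻¹ ∉ S → a g h = 0) :
    ∑ g ∈ W, ‖∑ h ∈ T, a g h * u h‖ ^ 2 ≤ (B * S.card) ^ 2 * ∑ h ∈ T, ‖u h‖ ^ 2 := by
  classical
  have hrow (g : Γ) : ‖∑ h ∈ T, a g h * u h‖ ^ 2 ≤
      B ^ 2 * S.card * ∑ h ∈ T with g * h⁻¹ ∈ S, ‖u h‖ ^ 2 := by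
    have hcard : (T.filter fun h => g * h⁻¹ ∈ S).card ≤ S.card :=
      Finset.card_le_card_of_injOn (fun h => g * h⁻¹)
        (fun h hh => (Finset.mem_filter.1 hh).2) (fun h _ h' _ hh => by simpa using hh)
    have h1 : ∑ h ∈ T, a g h * u h = ∑ h ∈ T with g * h⁻¹ ∈ S, a g h * u h := by
      rw [Finset.sum_filter]
      refine Finset.sum_congr rfl fun h _ => ?_
      split_ifs with hh
      · rfl
      · simp [ha0 g h hh]
    have h2 : ‖∑ h ∈ T, a g h * u h‖ ≤ B * ∑ h ∈ T with g * h⁻¹ ∈ S, ‖u h‖ := by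
      rw [h1, Finset.mul_sum]
      refine norm_sum_le_of_le _ fun h _ => ?_
      rw [norm_mul]
      exact mul_le_mul_of_nonneg_right (ha g h) (norm_nonneg _)
    calc ‖∑ h ∈ T, a g h * u h‖ ^ 2
        ≤ (B * ∑ h ∈ T with g * h⁻¹ ∈ S, ‖u h‖) ^ 2 := by gcongr
      _ = B ^ 2 * (∑ h ∈ T with g * h⁻¹ ∈ S, ‖u h‖) ^ 2 := by ring
      _ ≤ B ^ 2 * ((T.filter fun h => g * h⁻¹ ∈ S).card *
            ∑ h ∈ T with g * h⁻¹ ∈ S, ‖u h‖ ^ 2) := by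
          gcongr
          exact sq_sum_le_card_mul_sum_sq
      _ ≤ B ^ 2 * (S.card * ∑ h ∈ T with g * h⁻¹ ∈ S, ‖u h‖ ^ 2) := by gcongr
      _ = _ := by ring
  have hcol (h : Γ) : ((W.filter fun g => g * h⁻¹ ∈ S).card : ℝ) ≤ S.card := by
    exact_mod_cast Finset.card_le_card_of_injOn (fun g => g * h⁻¹)
      (fun g hg => (Finset.mem_filter.1 hg).2) (fun g _ g' _ hh => by simpa using hh)
  calc ∑ g ∈ W, ‖∑ h ∈ T, a g h * u h‖ ^ 2
      ≤ ∑ g ∈ W, B ^ 2 * S.card * ∑ h ∈ T with g * h⁻¹ ∈ S, ‖u h‖ ^ 2 :=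
        Finset.sum_le_sum fun g _ => hrow g
    _ = B ^ 2 * S.card * ∑ h ∈ T, (W.filter fun g => g * h⁻¹ ∈ S).card * ‖u h‖ ^ 2 := by
        rw [← Finset.mul_sum]
        simp only [Finset.sum_filter]
        rw [Finset.sum_comm]
        congr 1
        refine Finset.sum_congr rfl fun h _ => ?_
        rw [← Finset.sum_filter, Finset.sum_const, nsmul_eq_mul]
    _ ≤ B ^ 2 * S.card * ∑ h ∈ T, S.card * ‖u h‖ ^ 2 := by
        refine mul_le_mul_of_nonneg_left (Finset.sum_le_sum fun h _ => ?_) (by positivity)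
        exact mul_le_mul_of_nonneg_right (hcol h) (by positivity)
    _ = _ := by rw [← Finset.mul_sum]; ring

lemma IsLength.abs_sub_le {ℓ : Γ → X → ℝ} (hℓ : IsLength ℓ) (g h : Γ) (x : X) :
    |ℓ g x - ℓ h x| ≤ ℓ (g * h⁻¹) (h • x) := by
  obtain ⟨-, -, -, hinv, htri⟩ := hℓ
  have h1 := htri (g * h⁻¹) h x
  have h2 := htri (g * h⁻¹)⁻¹ g x
  have h3 := hinv (g * h⁻¹) (h • x)
  simp only [smul_smul, mul_inv_rev, inv_inv,
    mul_assoc, inv_mul_cancel, mul_one] at h1 h2 h3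
  rw [abs_sub_le_iff]
  constructor <;> linarith

lemma IsCc.hnorm_deltaIter_le_lipK [CompactSpace X] [ContinuousConstSMul Γ X]
    {ℓ : Γ → X → ℝ} (hℓ : IsLength ℓ) {f ξ : Γ → X → ℂ} (hf : IsCc f) (hξ : IsCc ξ)
    (hξ1 : hnorm ξ ≤ 1) (k : ℕ) : hnorm (deltaIter ℓ f k ξ) ≤ lipK ℓ k f := by
  obtain ⟨S, hS⟩ := hf.exists_finset
  have hcont : Continuous fun y : X => ∑ s ∈ S, ℓ s y ^ k * ‖f s y‖ := by
    have := hf.1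
    have := hℓ.1
    fun_prop
  obtain ⟨B₀, hB₀⟩ := (isCompact_range hcont).bddAbove
  have hBf (s : Γ) (y : X) : ℓ s y ^ k * ‖f s y‖ ≤ max B₀ 0 := by
    by_cases hs : s ∈ S
    · refine le_max_of_le_left (le_trans ?_ (hB₀ (Set.mem_range_self y)))
      exact Finset.single_le_sum (f := fun s => ℓ s y ^ k * ‖f s y‖)
        (fun t _ => mul_nonneg (pow_nonneg (hℓ.2.1 t y) k) (norm_nonneg _)) hs
    · simp [hS s hs]
  refine le_csSup ⟨max B₀ 0 * S.card, ?_⟩ ⟨ξ, hξ, hξ1, rfl⟩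
  rintro _ ⟨η, hη, hη1, rfl⟩
  obtain ⟨T, hT⟩ := hη.exists_finset
  obtain ⟨W, hW⟩ := (isCc_deltaIter hℓ.1 hf hη k).exists_finset
  refine Real.iSup_le (fun x => Real.sqrt_le_iff.2 ⟨by positivity, ?_⟩) (by positivity)
  have hη2 := (hη.sqrt_le_hnorm x).trans hη1
  rw [Real.sqrt_le_one, finsum_eq_sum_of_forall_notMem T fun h hh => by simp [hT h hh]] at hη2
  rw [finsum_eq_sum_of_forall_notMem W fun g hg => by simp [hW g hg]]
  simp only [deltaIter_apply ℓ f k T hT]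
  refine (sum_sq_norm_le (S := S) (B := max B₀ 0) (fun g h => ?_)
    fun g h hgh => ?_).trans (mul_le_of_le_one_right (by positivity) hη2)
  · rw [norm_mul, norm_pow, ← Complex.ofReal_sub, Complex.norm_real, Real.norm_eq_abs]
    refine le_trans ?_ (hBf (g * h⁻¹) (h • x))
    gcongr
    exact hℓ.abs_sub_le g h x
  · simp [hS _ hgh]

lemma sum_sq_column_le_one [CompactSpace X] [ContinuousConstSMul Γ X]
    {ℓ : Γ → X → ℝ} (hℓ : IsLength ℓ) {f : Γ → X → ℂ} (hf : IsCc f) {k : ℕ}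
    (hk : lipK ℓ k f ≤ 1) {S : Finset Γ} (hS : ∀ g, g ∉ S → f g = 0) (x : X) :
    ∑ g ∈ S, ‖f g x‖ ^ 2 * ℓ g x ^ (2 * k) ≤ 1 := by
  classical
  set ξ : Γ → X → ℂ := Pi.single 1 1
  have hT : ∀ h, h ∉ ({1} : Finset Γ) → ξ h = 0 := fun h hh => by
    simp only [Finset.mem_singleton] at hh
    simp [ξ, hh]
  have hξ : IsCc ξ := by
    refine isCc_of_finset (fun g => ?_) {1} hT
    by_cases hg : g = 1
    · subst hg
      simpa [ξ] using (continuous_one : Continuous (1 : X → ℂ))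
    · rw [hT g (by simpa using hg)]
      exact continuous_const
  have hξ1 : hnorm ξ ≤ 1 := by
    refine Real.iSup_le (fun x => ?_) zero_le_one
    rw [finsum_eq_sum_of_forall_notMem {1} fun h hh => by simp [hT h hh]]
    simp [ξ]
  have h1 := (((isCc_deltaIter hℓ.1 hf hξ k).sqrt_le_hnorm x).trans
    (hf.hnorm_deltaIter_le_lipK hℓ hξ hξ1 k)).trans hk
  have hℓ1 : ℓ 1 x = 0 := (hℓ.2.2.1 1 x).2 rfl
  have happ (g : Γ) : deltaIter ℓ f k ξ g x = (ℓ g x : ℂ) ^ k * f g x := by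
    rw [deltaIter_apply ℓ f k {1} hT]
    simp [ξ, hℓ1]
  simp only [happ, Real.sqrt_le_one] at h1
  rw [finsum_eq_sum_of_forall_notMem S fun g hg => by simp [hS g hg]] at h1
  refine le_of_eq_of_le (Finset.sum_congr rfl fun g _ => ?_) h1
  rw [norm_mul, norm_pow, Complex.norm_real, Real.norm_of_nonneg (hℓ.2.1 g x)]
  ring

lemma sum_sq_row_le_one [CompactSpace X] [ContinuousConstSMul Γ X]
    {ℓ : Γ → X → ℝ} (hℓ : IsLength ℓ) {f : Γ → X → ℂ} (hf : IsCc f) {k : ℕ}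
    (hk : lipK ℓ k f ≤ 1) (T : Finset Γ) (x : X) :
    ∑ h ∈ T, ‖f h⁻¹ (h • x)‖ ^ 2 * ℓ h x ^ (2 * k) ≤ 1 := by
  classical
  have hℓ1 : ℓ 1 x = 0 := (hℓ.2.2.1 1 x).2 rfl
  set a : Γ → ℂ := fun h => ((ℓ 1 x : ℂ) - ℓ h x) ^ k * f (1 * h⁻¹) (h • x) with ha
  have hnorm_a (h : Γ) : ‖f h⁻¹ (h • x)‖ ^ 2 * ℓ h x ^ (2 * k) = ‖a h‖ ^ 2 := by
    simp only [ha, hℓ1, Complex.ofReal_zero, zero_sub, one_mul]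
    rw [norm_mul, norm_pow, norm_neg, Complex.norm_real, Real.norm_of_nonneg (hℓ.2.1 h x)]
    ring
  simp only [hnorm_a]
  set N : ℝ := √(∑ h ∈ T, ‖a h‖ ^ 2) with hN
  have hN2 : N ^ 2 = ∑ h ∈ T, ‖a h‖ ^ 2 := Real.sq_sqrt (by positivity)
  rcases (Real.sqrt_nonneg _ : 0 ≤ N).eq_or_lt with h0 | h0
  · rw [← hN2, hN, ← h0]; norm_num
  set ξ : Γ → X → ℂ := fun h _ => if h ∈ T then (starRingEnd ℂ) (a h) / N else 0
  have hT : ∀ h, h ∉ T → ξ h = 0 := fun h hh => by ext; simp [ξ, hh]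
  have hξ : IsCc ξ := isCc_of_finset (fun g => continuous_const) T hT
  have hξ1 : hnorm ξ ≤ 1 := by
    refine Real.iSup_le (fun y => ?_) zero_le_one
    rw [finsum_eq_sum_of_forall_notMem T fun h hh => by simp [hT h hh], Real.sqrt_le_one]
    have : ∑ h ∈ T, ‖ξ h y‖ ^ 2 = ∑ h ∈ T, ‖a h‖ ^ 2 / N ^ 2 := by
      refine Finset.sum_congr rfl fun h hh => ?_
      simp [ξ, hh, div_pow]
    rw [this, ← Finset.sum_div, hN2, div_self (by rw [← hN2]; positivity)]
  have hδ := isCc_deltaIter hℓ.1 hf hξ k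
  have h1 := ((hδ.sqrt_le_hnorm x).trans (hf.hnorm_deltaIter_le_lipK hℓ hξ hξ1 k)).trans hk
  rw [Real.sqrt_le_one] at h1
  have hval : deltaIter ℓ f k ξ 1 x = N := by
    rw [deltaIter_apply ℓ f k T hT]
    have : ∀ h ∈ T, ((ℓ 1 x : ℂ) - ℓ h x) ^ k * f (1 * h⁻¹) (h • x) * ξ h x =
        ((‖a h‖ ^ 2 : ℝ) : ℂ) / N := fun h hh => by
      simp only [ξ, hh, if_true]
      rw [← mul_div_assoc, Complex.mul_conj, Complex.normSq_eq_norm_sq]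
    rw [Finset.sum_congr rfl this, ← Finset.sum_div, ← Complex.ofReal_sum, ← hN2,
      ← Complex.ofReal_div]
    congr 1
    field_simp
  have h2 : ‖deltaIter ℓ f k ξ 1 x‖ ^ 2 ≤ ∑ᶠ g : Γ, ‖deltaIter ℓ f k ξ g x‖ ^ 2 := by
    refine single_le_finsum (f := fun g => ‖deltaIter ℓ f k ξ g x‖ ^ 2) 1
      (hδ.2.subset fun g hg hg0 => ?_) fun g => by positivity
    simp [hg0] at hg
  rw [hval, Complex.norm_real, Real.norm_of_nonneg h0.le] at h2
  rw [← hN2]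
  exact h2.trans h1

lemma exists_pos_le_length [CompactSpace X] {ℓ : Γ → X → ℝ} (hℓ : IsLength ℓ)
    (hprop : IsProperLen ℓ) : ∃ m : ℝ, 0 < m ∧ ∀ g : Γ, g ≠ 1 → ∀ x : X, m ≤ ℓ g x := by
  rcases isEmpty_or_nonempty X with hX | hX
  · exact ⟨1, one_pos, fun g _ x => isEmptyElim x⟩
  have hmin (g : Γ) : ∃ y : X, ∀ x, ℓ g y ≤ ℓ g x := by
    obtain ⟨y, -, hy⟩ := isCompact_univ.exists_isMinOn Set.univ_nonempty (hℓ.1 g).continuousOn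
    exact ⟨y, fun x => hy (Set.mem_univ x)⟩
  choose y hy using hmin
  set F := (hprop 1).toFinset
  obtain ⟨m, hm, hmF⟩ : ∃ m : ℝ, 0 < m ∧ ∀ g ∈ F, m ≤ ℓ g (y g) := by
    rcases F.eq_empty_or_nonempty with hF | hF
    · exact ⟨1, one_pos, by simp [hF]⟩
    · obtain ⟨g₀, hg₀, hle⟩ := F.exists_min_image (fun g => ℓ g (y g)) hF
      refine ⟨ℓ g₀ (y g₀), lt_of_le_of_ne (hℓ.2.1 _ _) fun h => ?_, hle⟩
      exact ((hprop 1).mem_toFinset.1 hg₀).1 ((hℓ.2.2.1 _ _).1 h.symm)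
  refine ⟨min m 1, lt_min hm one_pos, fun g hg x => ?_⟩
  by_cases h : ℓ g x ≤ 1
  · exact (min_le_left _ _).trans
      ((hmF g ((hprop 1).mem_toFinset.2 ⟨hg, x, h⟩)).trans (hy g x))
  · exact (min_le_right _ _).trans (not_le.1 h).le

lemma one_add_rpow_le {p t m : ℝ} {k : ℕ} (hk : p ≤ k) (hm : 0 < m) (ht : m ≤ t) :
    (1 + t) ^ (2 * p) ≤ ((1 + 1 / m) ^ k) ^ 2 * t ^ (2 * k) := by
  have ht0 : 0 < t := hm.trans_le ht
  have h1 : 1 + t ≤ (1 + 1 / m) * t := by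
    have : 1 ≤ 1 / m * t := by rw [one_div, inv_mul_eq_div, one_le_div hm]; exact ht
    linarith
  calc (1 + t) ^ (2 * p) ≤ (1 + t) ^ (((2 * k : ℕ) : ℝ)) := by
        apply Real.rpow_le_rpow_of_exponent_le (by linarith)
        push_cast
        linarith
    _ = (1 + t) ^ (2 * k) := Real.rpow_natCast _ _
    _ ≤ ((1 + 1 / m) * t) ^ (2 * k) := by gcongr
    _ = _ := by rw [mul_pow, ← pow_mul, mul_comm k 2]

/-- `‖·‖_{2,p,ℓ}` is controlled by `L_ℓ^k` off the unit space. -/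
lemma norm2_le_of_lipK_le_one [CompactSpace X] [ContinuousConstSMul Γ X]
    {ℓ : Γ → X → ℝ} (hℓ : IsLength ℓ) {p m : ℝ} {k : ℕ} (hk : p ≤ k) (hm : 0 < m)
    (hmℓ : ∀ g : Γ, g ≠ 1 → ∀ x : X, m ≤ ℓ g x) {f f' : Γ → X → ℂ} (hf : IsCc f)
    (hfk : lipK ℓ k f ≤ 1) (h1 : f' 1 = 0) (hne : ∀ g, g ≠ 1 → f' g = f g) :
    norm2 ℓ p f' ≤ (1 + 1 / m) ^ k := by
  classical
  obtain ⟨S, hS⟩ := hf.exists_finset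
  have hS' : ∀ g, g ∉ S → f' g = 0 := fun g hg => by
    by_cases hg1 : g = 1
    · rw [hg1, h1]
    · rw [hne g hg1, hS g hg]
  have hterm (g h : Γ) (hgh : g = 1 ↔ h = 1) (x y : X) :
      ‖f' g y‖ ^ 2 * (1 + ℓ h x) ^ (2 * p) ≤
        ((1 + 1 / m) ^ k) ^ 2 * (‖f g y‖ ^ 2 * ℓ h x ^ (2 * k)) := by
    have hℓ0 := hℓ.2.1 h x
    by_cases hg : g = 1
    · rw [hg, h1]
      simp only [Pi.zero_apply, norm_zero]
      rw [zero_pow two_ne_zero, zero_mul]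
      positivity
    · rw [hne g hg, mul_left_comm]
      exact mul_le_mul_of_nonneg_left
        (one_add_rpow_le hk hm (hmℓ h (fun h' => hg (hgh.2 h')) x)) (by positivity)
  refine max_le ?_ ?_ <;>
    refine Real.iSup_le (fun x => Real.sqrt_le_iff.2 ⟨by positivity, ?_⟩) (by positivity)
  · rw [finsum_eq_sum_of_forall_notMem S fun g hg => by simp [hS' g hg]]
    refine (Finset.sum_le_sum fun g _ => hterm g g Iff.rfl x x).trans ?_
    rw [← Finset.mul_sum]
    exact mul_le_of_le_one_right (by positivity) (sum_sq_column_le_one hℓ hf hfk hS x)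
  · rw [finsum_eq_sum_of_forall_notMem (S.image (·⁻¹)) fun g hg => by
      rw [hS' g⁻¹ fun h => hg (Finset.mem_image.2 ⟨_, h, inv_inv g⟩)]; simp]
    refine (Finset.sum_le_sum fun g _ => hterm g⁻¹ g inv_eq_one x (g • x)).trans ?_
    rw [← Finset.mul_sum]
    exact mul_le_of_le_one_right (by positivity) (sum_sq_row_le_one hℓ hf hfk _ x)

/-- under rapid decay, each fibre `S_η` of the state space has finite
`ρ_{L_ℓ^k}`-diameter, uniformly bounded over `η`: there is `D > 0` such that any two
norm-`≤ 1` functionals (w.r.t. `‖·‖_red`) agreeing on the copy of `C(X)` are at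
distance at most `D` on the `L_ℓ^k`-unit ball. -/
theorem stmt_13 [CompactSpace X] [T2Space X] [ContinuousConstSMul Γ X]
    (ℓ : Γ → X → ℝ) (hℓ : IsLength ℓ) (hprop : IsProperLen ℓ)
    (p C : ℝ) (hp : 0 < p) (hC : 0 < C)
    (hRD : ∀ f : Γ → X → ℂ, IsCc f → redNorm f ≤ C * norm2 ℓ p f)
    (k : ℕ) (hk : p < (k : ℝ)) :
    ∃ D : ℝ, 0 < D ∧ ∀ φ ψ : (Γ → X → ℂ) →ₗ[ℂ] ℂ,
      (∀ f : Γ → X → ℂ, IsCc f → ‖φ f‖ ≤ redNorm f) →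
      (∀ f : Γ → X → ℂ, IsCc f → ‖ψ f‖ ≤ redNorm f) →
      (∀ h : Γ → X → ℂ, IsCc h → (∀ g : Γ, g ≠ 1 → h g = 0) → φ h = ψ h) →
      ∀ f : Γ → X → ℂ, IsCc f → lipK ℓ k f ≤ 1 → ‖φ f - ψ f‖ ≤ D := by
  classical
  obtain ⟨m, hm, hmℓ⟩ := exists_pos_le_length hℓ hprop
  refine ⟨2 * (C * (1 + 1 / m) ^ k), by positivity, fun φ ψ hφ hψ hφψ f hf hfk => ?_⟩
  set d : Γ → X → ℂ := Pi.single 1 (f 1)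
  have hd0 : ∀ g, g ≠ 1 → d g = 0 := fun g hg => by simp [d, hg]
  have hd1 : d 1 = f 1 := by simp [d]
  have hd : IsCc d := by
    refine isCc_of_finset (fun g => ?_) {1} fun g hg => hd0 g (by simpa using hg)
    by_cases hg : g = 1
    · rw [hg, hd1]
      exact hf.1 1
    · rw [hd0 g hg]
      exact continuous_const
  have hfd : IsCc (f - d) := by
    obtain ⟨S, hS⟩ := hf.exists_finset
    refine isCc_of_finset (fun g => (hf.1 g).sub (hd.1 g)) (insert 1 S) fun g hg => ?_
    rw [Finset.mem_insert, not_or] at hg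
    simp [hd0 g hg.1, hS g hg.2]
  have hred : redNorm (f - d) ≤ C * (1 + 1 / m) ^ k := by
    refine (hRD _ hfd).trans (mul_le_mul_of_nonneg_left ?_ hC.le)
    exact norm2_le_of_lipK_le_one hℓ hk.le hm hmℓ hf hfk (by simp [hd1])
      fun g hg => by simp [hd0 g hg]
  have heq : φ f - ψ f = φ (f - d) - ψ (f - d) := by
    rw [map_sub, map_sub, hφψ d hd hd0]
    ring
  rw [heq]
  linarith [norm_sub_le (φ (f - d)) (ψ (f - d)), hφ _ hfd, hψ _ hfd]
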